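/- Let i ∈ ℂ be the imaginary unit and let F(x) = (x₁ − i·x₀)² + 2(x₃ − i·x₂)² + x₀² + x₁² + x₂² + x₃² for x ∈ ℂ⁴, with gradient ∇F(x) = 2(x₁ − i·x₀)·(−i, 1, 0, 0) + 4(x₃ − i·x₂)·(0, 0, −i, 1) + 2x. There exists a nonzero polynomial g in four complex variables such that for every u ∈ ℂ⁴ with g(u) ≠ 0, the set { x ∈ ℂ⁴ : x ≠ 0, F(x) = 0, and there exists λ ∈ ℂ with x − u = λ·∇F(x) } has exactly 1 element. -/

import Mathlib

open Complex

/-- The critical equation `x - u = l • ∇F(x)`, coordinate by coordinate. -/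
lemma sub_eq_smul_gradient_iff (x u : Fin 4 → ℂ) (l : ℂ) :
    x - u = l • ((2 * (x 1 - I * x 0)) • ![-I, 1, 0, 0] +
      (4 * (x 3 - I * x 2)) • ![0, 0, -I, 1] + (2 : ℂ) • x) ↔
    (1 - 2 * l) * x 0 = u 0 - 2 * l * I * (x 1 - I * x 0) ∧
    (1 - 2 * l) * x 1 = u 1 + 2 * l * (x 1 - I * x 0) ∧
    (1 - 2 * l) * x 2 = u 2 - 4 * l * I * (x 3 - I * x 2) ∧
    (1 - 2 * l) * x 3 = u 3 + 4 * l * (x 3 - I * x 2) := by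
  rw [funext_iff, Fin.forall_fin_succ, Fin.forall_fin_succ, Fin.forall_fin_two]
  simp only [Pi.sub_apply, Pi.smul_apply, Pi.add_apply, smul_eq_mul]
  simp
  refine and_congr ?_ (and_congr ?_ (and_congr ?_ ?_)) <;>
    constructor <;> intro h <;> linear_combination h

/-- The point with `1 - 2 * l = t` on the curve of solutions of the critical equation. -/
noncomputable def criticalPoint (u : Fin 4 → ℂ) (t : ℂ) : Fin 4 → ℂ :=
  ![(u 0 - I * (1 - t) * ((u 1 - I * u 0) / t)) / t,
    (u 1 + (1 - t) * ((u 1 - I * u 0) / t)) / t,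
    (u 2 - 2 * I * (1 - t) * ((u 3 - I * u 2) / t)) / t,
    (u 3 + 2 * (1 - t) * ((u 3 - I * u 2) / t)) / t]

lemma criticalPoint_one_sub (u : Fin 4 → ℂ) {t : ℂ} (ht : t ≠ 0) :
    criticalPoint u t 1 - I * criticalPoint u t 0 = (u 1 - I * u 0) / t := by
  simp only [criticalPoint, Matrix.cons_val]
  field_simp
  linear_combination (1 - t) * (u 1 - I * u 0) * I_sq

lemma criticalPoint_three_sub (u : Fin 4 → ℂ) {t : ℂ} (ht : t ≠ 0) :
    criticalPoint u t 3 - I * criticalPoint u t 2 = (u 3 - I * u 2) / t := by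
  simp only [criticalPoint, Matrix.cons_val]
  field_simp
  linear_combination 2 * (1 - t) * (u 3 - I * u 2) * I_sq

lemma sub_eq_smul_gradient_iff_eq_criticalPoint (x u : Fin 4 → ℂ) {l : ℂ}
    (hl : 1 - 2 * l ≠ 0) :
    x - u = l • ((2 * (x 1 - I * x 0)) • ![-I, 1, 0, 0] +
      (4 * (x 3 - I * x 2)) • ![0, 0, -I, 1] + (2 : ℂ) • x) ↔
    x = criticalPoint u (1 - 2 * l) := by
  rw [sub_eq_smul_gradient_iff]
  constructor
  · rintro ⟨h0, h1, h2, h3⟩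
    have hp : x 1 - I * x 0 = (u 1 - I * u 0) / (1 - 2 * l) := by
      rw [eq_div_iff hl]
      linear_combination h1 - I * h0 + 2 * l * (x 1 - I * x 0) * I_sq
    have hr : x 3 - I * x 2 = (u 3 - I * u 2) / (1 - 2 * l) := by
      rw [eq_div_iff hl]
      linear_combination h3 - I * h2 + 4 * l * (x 3 - I * x 2) * I_sq
    ext i
    fin_cases i <;> simp only [criticalPoint, Fin.reduceFinMk, Fin.zero_eta, Fin.mk_one,
      Matrix.cons_val, ← hp, ← hr] <;> rw [eq_div_iff hl]
    · linear_combination h0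
    · linear_combination h1
    · linear_combination h2
    · linear_combination h3
  · rintro rfl
    rw [criticalPoint_one_sub u hl, criticalPoint_three_sub u hl]
    simp only [criticalPoint, Matrix.cons_val]
    refine ⟨?_, ?_, ?_, ?_⟩ <;> rw [mul_div_cancel₀ _ hl] <;> ring

/-- On the curve of critical points, the quadric becomes a linear equation in `t`. -/
lemma quadric_criticalPoint (u : Fin 4 → ℂ) {t : ℂ} (ht : t ≠ 0) :
    t ^ 3 * ((criticalPoint u t 1 - I * criticalPoint u t 0) ^ 2 +
        2 * (criticalPoint u t 3 - I * criticalPoint u t 2) ^ 2 +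
        (criticalPoint u t 0 ^ 2 + criticalPoint u t 1 ^ 2 +
          criticalPoint u t 2 ^ 2 + criticalPoint u t 3 ^ 2)) =
      2 * ((u 1 - I * u 0) ^ 2 + 2 * (u 3 - I * u 2) ^ 2) -
      t * ((u 1 - I * u 0) ^ 2 + 2 * (u 3 - I * u 2) ^ 2 -
        (u 0 ^ 2 + u 1 ^ 2 + u 2 ^ 2 + u 3 ^ 2)) := by
  rw [criticalPoint_one_sub u ht, criticalPoint_three_sub u ht]
  simp only [criticalPoint, Matrix.cons_val]
  field_simp
  linear_combination ((1 - t) ^ 2 * (u 1 - I * u 0) ^ 2 +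
    4 * (1 - t) ^ 2 * (u 3 - I * u 2) ^ 2) * I_sq

/-- The unit Euclidean distance degree of the quadric
`F = (x₁ - i x₀)² + 2(x₃ - i x₂)² + x₀² + x₁² + x₂² + x₃²` is `1`: there is a
nonzero polynomial `g` in the data `u` such that whenever `g(u) ≠ 0`, there is
exactly one nonzero point `x` with `F(x) = 0` at which `x - u` is a complex
scalar multiple of the gradient `∇F(x)`. -/
theorem stmt_11 :
    ∃ g : MvPolynomial (Fin 4) ℂ, g ≠ 0 ∧
      ∀ u : Fin 4 → ℂ, MvPolynomial.eval u g ≠ 0 →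
        Set.ncard {x : Fin 4 → ℂ | x ≠ 0 ∧
          (x 1 - I * x 0) ^ 2 + 2 * (x 3 - I * x 2) ^ 2 +
            ((x 0) ^ 2 + (x 1) ^ 2 + (x 2) ^ 2 + (x 3) ^ 2) = 0 ∧
          ∃ l : ℂ, x - u =
            l • ((2 * (x 1 - I * x 0)) • ![-I, 1, 0, 0] +
              (4 * (x 3 - I * x 2)) • ![0, 0, -I, 1] + (2 : ℂ) • x)} = 1 := by
  let a : MvPolynomial (Fin 4) ℂ := .X 1 - .C I * .X 0
  let c : MvPolynomial (Fin 4) ℂ := .X 3 - .C I * .X 2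
  let n : MvPolynomial (Fin 4) ℂ := a ^ 2 + 2 * c ^ 2
  let m : MvPolynomial (Fin 4) ℂ := .X 0 ^ 2 + .X 1 ^ 2 + .X 2 ^ 2 + .X 3 ^ 2
  have eval_g (u : Fin 4 → ℂ) : MvPolynomial.eval u (a * n * (n - m)) =
      (u 1 - I * u 0) * ((u 1 - I * u 0) ^ 2 + 2 * (u 3 - I * u 2) ^ 2) *
      ((u 1 - I * u 0) ^ 2 + 2 * (u 3 - I * u 2) ^ 2 -
        (u 0 ^ 2 + u 1 ^ 2 + u 2 ^ 2 + u 3 ^ 2)) := by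
    simp [a, c, n, m]
  refine ⟨a * n * (n - m), fun h => ?_, fun u hu => ?_⟩
  · have := eval_g ![I, 1, 0, 0]
    rw [h] at this
    simp only [map_zero, Matrix.cons_val, I_mul_I, I_sq] at this
    norm_num at this
  rw [eval_g] at hu
  obtain ⟨⟨ha, hN⟩, hD⟩ : (_ ∧ _) ∧ _ := by simpa only [mul_ne_zero_iff] using hu
  set N := (u 1 - I * u 0) ^ 2 + 2 * (u 3 - I * u 2) ^ 2 with hNdef
  set D := N - (u 0 ^ 2 + u 1 ^ 2 + u 2 ^ 2 + u 3 ^ 2) with hDdef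
  have ht : 2 * N / D ≠ 0 := div_ne_zero (mul_ne_zero two_ne_zero hN) hD
  refine Set.ncard_eq_one.mpr ⟨criticalPoint u (2 * N / D), ?_⟩
  ext x
  simp only [Set.mem_ofPred_eq, Set.mem_singleton_iff]
  constructor
  · rintro ⟨-, hF, l, hl⟩
    have htl : 1 - 2 * l ≠ 0 := by
      intro h0
      obtain ⟨h1, h2, -, -⟩ := (sub_eq_smul_gradient_iff x u l).mp hl
      apply ha
      linear_combination (x 1 - I * x 0) * h0 - h2 + I * h1 -
        2 * l * (x 1 - I * x 0) * I_sq
    rw [sub_eq_smul_gradient_iff_eq_criticalPoint x u htl] at hl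
    subst hl
    have hq := quadric_criticalPoint u htl
    rw [hF, mul_zero, ← hNdef, ← hDdef] at hq
    congr 1
    rw [eq_div_iff hD]
    linear_combination hq
  · rintro rfl
    refine ⟨fun h => ?_, ?_, (1 - 2 * N / D) / 2, ?_⟩
    · have hp := criticalPoint_one_sub u ht
      rw [h] at hp
      exact div_ne_zero ha ht (by simpa using hp.symm)
    · have hq := quadric_criticalPoint u ht
      rw [← hNdef, ← hDdef, div_mul_cancel₀ _ hD, sub_self] at hq
      exact (mul_eq_zero.mp hq).resolve_left (pow_ne_zero 3 ht)
    · have hl : 1 - 2 * ((1 - 2 * N / D) / 2) = 2 * N / D := by ring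
      rw [sub_eq_smul_gradient_iff_eq_criticalPoint _ u (by rwa [hl]), hl]
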